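/- Consider f(t,u,v,w,z) = t·e^u·(1 + z²) and H[u] = 1/(1 + u(1/2)²) + ∫₀¹ t³ u″(t) dt. For every ρ ∈ (0, +∞) there exist λ_ρ ∈ (0, +∞) and u_ρ ∈ ∂K_ρ with ‖u_ρ‖₃ = ‖u_ρ‴‖_∞ = ρ satisfying u_ρ(t) = λ_ρ ( γ(t) H[u_ρ] + ∫₀¹ k(t,s) s e^{u_ρ(s)} (1 + (u_ρ‴(s))²) ds ) on [0,1], and moreover 4ρ / (2e^ρ ρ² + 2e^ρ + ρ + 4) ≤ λ_ρ ≤ 2ρ(ρ² + 1)/(ρ² + 3). -/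

import Mathlib

open Set MeasureTheory Filter Topology

/-- The Green's function `k(t,s) = (1/6)(3t²s − t³)` for `s ≥ t`,
`k(t,s) = (1/6)(3s²t − s³)` for `s ≤ t`. -/
noncomputable def kern (t s : ℝ) : ℝ :=
  if t ≤ s then (3 * t ^ 2 * s - t ^ 3) / 6 else (3 * s ^ 2 * t - s ^ 3) / 6

/-- `γ(t) = (1/6)(3t² − t³)`. -/
noncomputable def gam (t : ℝ) : ℝ := (3 * t ^ 2 - t ^ 3) / 6

/-- The sup norm over `[0,1]`: `‖w‖_∞ = sup_{t∈[0,1]} |w(t)|`. -/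
noncomputable def supN (w : ℝ → ℝ) : ℝ := ⨆ t : Icc (0:ℝ) 1, |w ↑t|

/-- The `C³[0,1]` norm `‖u‖₃ = max_{j=0,…,3} ‖u⁽ʲ⁾‖_∞`. -/
noncomputable def norm3 (u : ℝ → ℝ) : ℝ :=
  max (max (supN u) (supN (deriv u))) (max (supN (deriv^[2] u)) (supN (deriv^[3] u)))

/-- The cone `K = {u ∈ C³[0,1] : u, u′, u″, −u‴ ≥ 0 on [0,1]}`, where elements of
`C³[0,1]` are represented by three times continuously differentiable functions on `ℝ`. -/
def coneK : Set (ℝ → ℝ) :=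
  {u | ContDiff ℝ 3 u ∧ ∀ t ∈ Icc (0:ℝ) 1,
    0 ≤ u t ∧ 0 ≤ deriv u t ∧ 0 ≤ deriv^[2] u t ∧ 0 ≤ -(deriv^[3] u t)}

/-- `K̄_ρ = {u ∈ K : ‖u‖₃ ≤ ρ}`. -/
def Kbar (ρ : ℝ) : Set (ℝ → ℝ) := {u ∈ coneK | norm3 u ≤ ρ}

/-- `∂K_ρ = {u ∈ K : ‖u‖₃ = ρ}`. -/
def Kbdry (ρ : ℝ) : Set (ℝ → ℝ) := {u ∈ coneK | norm3 u = ρ}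

/-- `Π_ρ = [0,1] × [0,ρ]³ × [−ρ,0]`. -/
def PiSet (ρ : ℝ) : Set (ℝ × ℝ × ℝ × ℝ × ℝ) :=
  {p | p.1 ∈ Icc (0:ℝ) 1 ∧ p.2.1 ∈ Icc 0 ρ ∧ p.2.2.1 ∈ Icc 0 ρ ∧
       p.2.2.2.1 ∈ Icc 0 ρ ∧ p.2.2.2.2 ∈ Icc (-ρ) 0}

/-- The operator `Tu(t) = γ(t)H[u] + ∫₀¹ k(t,s) f(s, u(s), u′(s), u″(s), u‴(s)) ds`. -/
noncomputable def Toper (f : ℝ × ℝ × ℝ × ℝ × ℝ → ℝ) (H : (ℝ → ℝ) → ℝ) (u : ℝ → ℝ) :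
    ℝ → ℝ :=
  fun t => gam t * H u +
    ∫ s in (0:ℝ)..1, kern t s * f (s, u s, deriv u s, deriv^[2] u s, deriv^[3] u s)

/-- Continuity of a functional `H` on a subset `S` of `C³[0,1]` with respect to `‖·‖₃`. -/
def ContOn3 (H : (ℝ → ℝ) → ℝ) (S : Set (ℝ → ℝ)) : Prop :=
  ∀ u ∈ S, ∀ ε > (0:ℝ), ∃ δ > (0:ℝ), ∀ v ∈ S, norm3 (u - v) < δ → |H u - H v| < ε

/-- Boundedness of a functional `H` on a subset `S` of `C³[0,1]`. -/
def BddOn3 (H : (ℝ → ℝ) → ℝ) (S : Set (ℝ → ℝ)) : Prop :=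
  ∃ M : ℝ, ∀ u ∈ S, |H u| ≤ M

/-- The nonlinearity of the example: `f(t,u,v,w,z) = t e^u (1 + z²)`. -/
noncomputable def fEx (p : ℝ × ℝ × ℝ × ℝ × ℝ) : ℝ :=
  p.1 * Real.exp p.2.1 * (1 + p.2.2.2.2 ^ 2)

/-- The functional of the example: `H[u] = 1/(1 + u(1/2)²) + ∫₀¹ t³ u″(t) dt`. -/
noncomputable def HEx (u : ℝ → ℝ) : ℝ :=
  1 / (1 + (u (1/2)) ^ 2) + ∫ t in (0:ℝ)..1, t ^ 3 * deriv^[2] u t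

lemma sub_le_sub_of_hasDerivAt_le {f f' g g' : ℝ → ℝ} {a b s t : ℝ}
    (hf : ∀ x ∈ Icc a b, HasDerivAt f (f' x) x) (hg : ∀ x ∈ Icc a b, HasDerivAt g (g' x) x)
    (h : ∀ x ∈ Icc a b, f' x ≤ g' x) (hs : s ∈ Icc a b) (ht : t ∈ Icc a b) (hst : s ≤ t) :
    f t - f s ≤ g t - g s := by
  have hmono : MonotoneOn (fun x => g x - f x) (Icc a b) := by
    refine monotoneOn_of_hasDerivWithinAt_nonneg (f' := fun x => g' x - f' x) (convex_Icc a b)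
      (fun x hx => ((hg x hx).sub (hf x hx)).continuousAt.continuousWithinAt)
      (fun x hx => ?_) (fun x hx => ?_)
    · exact ((hg x (interior_subset hx)).sub (hf x (interior_subset hx))).hasDerivWithinAt
    · exact sub_nonneg.2 (h x (interior_subset hx))
  have := hmono hs ht hst
  simp only at this
  linarith

/-- A bounded, globally Lipschitz vector field has a flow on `[-1, 2]`, which depends
continuously on the initial value. -/
lemma exists_flow_of_lipschitz_of_bounded {E : Type*} [NormedAddCommGroup E] [NormedSpace ℝ E]
    [CompleteSpace E] {F : E → E} {K : NNReal} (hF : LipschitzWith K F) {M : NNReal}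
    (hM : ∀ x, ‖F x‖ ≤ M) (r : NNReal) :
    ∃ α : E → ℝ → E,
      (∀ x ∈ Metric.closedBall (0 : E) r, α x 0 = x ∧
        ∀ t ∈ Icc (0 : ℝ) 1, HasDerivAt (α x) (F (α x t)) t) ∧
      ∀ t ∈ Icc (0 : ℝ) 1, ContinuousOn (fun x => α x t) (Metric.closedBall (0 : E) r) := by
  have hpl : IsPicardLindelof (fun _ => F) (⟨0, by norm_num⟩ : Icc (-1 : ℝ) 2) (0 : E)
      (2 * M + r) r M K := by
    refine IsPicardLindelof.of_time_independent (fun x _ => hM x) hF.lipschitzOnWith ?_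
    push_cast
    rw [max_eq_left (by norm_num)]
    linarith
  obtain ⟨α, hα, L, hL⟩ := hpl.exists_forall_mem_closedBall_eq_hasDerivWithinAt_lipschitzOnWith
  refine ⟨α, fun x hx => ⟨(hα x hx).1, fun t ht => ?_⟩, fun t ht => ?_⟩
  · exact ((hα x hx).2 t ⟨by linarith [ht.1], by linarith [ht.2]⟩).hasDerivAt
      (Icc_mem_nhds (by linarith [ht.1]) (by linarith [ht.2]))
  · exact (hL t ⟨by linarith [ht.1], by linarith [ht.2]⟩).continuousOn

/-- The truncation of `x` to the interval `[0, c]`. -/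
noncomputable def trunc (c x : ℝ) : ℝ := max 0 (min c x)

lemma trunc_nonneg (c x : ℝ) : 0 ≤ trunc c x := le_max_left _ _

lemma trunc_le {c : ℝ} (hc : 0 ≤ c) (x : ℝ) : trunc c x ≤ c := max_le hc (min_le_left _ _)

lemma trunc_mono (c : ℝ) : Monotone (trunc c) := fun _ _ h =>
  max_le_max le_rfl (min_le_min le_rfl h)

lemma trunc_of_mem {c x : ℝ} (h₀ : 0 ≤ x) (h₁ : x ≤ c) : trunc c x = x := by
  simp [trunc, h₀, h₁]

lemma trunc_of_nonpos {c x : ℝ} (hc : 0 ≤ c) (h : x ≤ 0) : trunc c x = 0 := by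
  simp [trunc, h, h.trans hc]

lemma lipschitzWith_trunc (c : ℝ) : LipschitzWith 1 (trunc c) :=
  (LipschitzWith.id.const_min c).const_max 0

lemma continuous_trunc (c : ℝ) : Continuous (trunc c) := (lipschitzWith_trunc c).continuous

/-- The initial value problem solved by the shooting method: `a` is the initial value of `u″`,
`l` is the eigenvalue parameter, `θ` stands for `arctan (-u‴)`, and `h` is a primitive of
`t³ u″`. All quantities are truncated to their a priori ranges. -/
structure IsShot (ρ a l : ℝ) (u v z θ h : ℝ → ℝ) : Prop where
  u_zero : u 0 = 0
  v_zero : v 0 = 0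
  z_zero : z 0 = a
  θ_zero : θ 0 = Real.arctan ρ
  h_zero : h 0 = 0
  deriv_u : ∀ t ∈ Icc (0 : ℝ) 1, HasDerivAt u (trunc ρ (v t)) t
  deriv_v : ∀ t ∈ Icc (0 : ℝ) 1, HasDerivAt v (trunc ρ (z t)) t
  deriv_z : ∀ t ∈ Icc (0 : ℝ) 1, HasDerivAt z (-Real.tan (trunc (Real.arctan ρ) (θ t))) t
  deriv_θ : ∀ t ∈ Icc (0 : ℝ) 1, HasDerivAt θ (-(l * t * Real.exp (trunc ρ (u t)))) t
  deriv_h : ∀ t ∈ Icc (0 : ℝ) 1, HasDerivAt h (t ^ 3 * trunc ρ (z t)) t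

/-- The autonomous vector field of the shooting problem, in the coordinates
`(u, v, z, θ, l, h, t)`, before truncation. -/
noncomputable def shotField (y : Fin 7 → ℝ) : Fin 7 → ℝ :=
  ![y 1, y 2, -Real.tan (y 3), -(y 4 * y 6 * Real.exp (y 0)), 0, y 6 ^ 3 * y 2, 1]

/-- The upper corner of the box to which the state of the shooting problem is truncated. -/
noncomputable def shotCorner (ρ : ℝ) : Fin 7 → ℝ := ![ρ, ρ, ρ, Real.arctan ρ, 4, 0, 1]

lemma contDiffOn_shotField (ρ : ℝ) : ContDiffOn ℝ 1 shotField (Icc 0 (shotCorner ρ)) := by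
  rw [contDiffOn_pi]
  intro i
  have hy : ∀ j, ContDiffOn ℝ 1 (fun y : Fin 7 → ℝ => y j) (Icc 0 (shotCorner ρ)) :=
    fun j => (contDiff_apply ℝ ℝ j).contDiffOn
  fin_cases i
  · exact hy 1
  · exact hy 2
  · intro y hy
    have h0 : 0 ≤ y 3 := hy.1 3
    have h1 : y 3 ≤ Real.arctan ρ := hy.2 3
    have hc : Real.cos (y 3) ≠ 0 := (Real.cos_pos_of_mem_Ioo
      ⟨by linarith [Real.pi_pos], h1.trans_lt (Real.arctan_lt_pi_div_two ρ)⟩).ne'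
    have h3 : ContDiffAt ℝ 1 (fun y : Fin 7 → ℝ => y 3) y := (contDiff_apply ℝ ℝ 3).contDiffAt
    exact (((Real.contDiffAt_tan.2 hc).comp y h3).neg).contDiffWithinAt
  · exact (((hy 4).mul (hy 6)).mul (hy 0).exp).neg
  · exact contDiffOn_const
  · exact ((hy 6).pow 3).mul (hy 2)
  · exact contDiffOn_const

lemma shotCorner_nonneg {ρ : ℝ} (hρ : 0 < ρ) : 0 ≤ shotCorner ρ := by
  have := Real.arctan_pos.2 hρ
  intro i
  fin_cases i <;> simp [shotCorner, hρ.le, this.le]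

lemma exists_shot_family {ρ : ℝ} (hρ : 0 < ρ) :
    ∃ u v z θ h : ℝ × ℝ → ℝ → ℝ,
      (∀ p ∈ Icc (0 : ℝ) ρ ×ˢ Icc (0 : ℝ) 4, IsShot ρ p.1 p.2 (u p) (v p) (z p) (θ p) (h p)) ∧
      ∀ t ∈ Icc (0 : ℝ) 1,
        ContinuousOn (fun p => u p t) (Icc (0 : ℝ) ρ ×ˢ Icc (0 : ℝ) 4) ∧
        ContinuousOn (fun p => z p t) (Icc (0 : ℝ) ρ ×ˢ Icc (0 : ℝ) 4) ∧
        ContinuousOn (fun p => θ p t) (Icc (0 : ℝ) ρ ×ˢ Icc (0 : ℝ) 4) ∧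
        ContinuousOn (fun p => h p t) (Icc (0 : ℝ) ρ ×ˢ Icc (0 : ℝ) 4) := by
  set B : (Fin 7 → ℝ) → Fin 7 → ℝ := fun y i => trunc (shotCorner ρ i) (y i) with hB
  have hBmem : ∀ y, B y ∈ Icc 0 (shotCorner ρ) := fun y =>
    ⟨fun i => trunc_nonneg _ _, fun i => trunc_le (shotCorner_nonneg hρ i) _⟩
  have hBlip : LipschitzWith 1 B := LipschitzWith.of_dist_le_mul fun x y => by
    rw [NNReal.coe_one, one_mul, dist_pi_le_iff dist_nonneg]
    intro i
    refine le_trans ((lipschitzWith_trunc (shotCorner ρ i)).dist_le_mul _ _) ?_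
    simpa using dist_le_pi_dist x y i
  have hG := contDiffOn_shotField ρ
  obtain ⟨K, hK⟩ := (hG.locallyLipschitzOn (convex_Icc _ _)).exists_lipschitzOnWith_of_compact
    isCompact_Icc
  have hF : LipschitzWith K (shotField ∘ B) := by
    have := hK.comp (hBlip.lipschitzOnWith (s := univ)) (fun y _ => hBmem y)
    simpa [lipschitzOnWith_univ] using this
  obtain ⟨M, hM⟩ := isCompact_Icc.exists_bound_of_continuousOn hG.continuousOn
  have hM' : ∀ y, ‖(shotField ∘ B) y‖ ≤ M.toNNReal := fun y =>
    (hM _ (hBmem y)).trans (Real.le_coe_toNNReal M)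
  set x : ℝ × ℝ → Fin 7 → ℝ := fun p => ![0, 0, p.1, Real.arctan ρ, p.2, 0, 0] with hx
  have hxc : Continuous x := by
    refine continuous_pi fun i => ?_
    fin_cases i <;> simp [hx] <;> fun_prop
  obtain ⟨r, hr⟩ := ((isCompact_Icc (a := (0 : ℝ)) (b := ρ)).prod
    (isCompact_Icc (a := (0 : ℝ)) (b := 4))).exists_bound_of_continuousOn hxc.continuousOn
  obtain ⟨α, hα, hαc⟩ := exists_flow_of_lipschitz_of_bounded hF hM' r.toNNReal
  have hxr : MapsTo x (Icc (0 : ℝ) ρ ×ˢ Icc (0 : ℝ) 4) (Metric.closedBall 0 r.toNNReal) :=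
    fun p hp => by
      rw [mem_closedBall_zero_iff]
      exact (hr p hp).trans (Real.le_coe_toNNReal r)
  have hcont : ∀ t ∈ Icc (0 : ℝ) 1, ∀ i,
      ContinuousOn (fun p => α (x p) t i) (Icc (0 : ℝ) ρ ×ˢ Icc (0 : ℝ) 4) := fun t ht i =>
    (continuous_apply i).comp_continuousOn ((hαc t ht).comp hxc.continuousOn hxr)
  refine ⟨fun p t => α (x p) t 0, fun p t => α (x p) t 1, fun p t => α (x p) t 2,
    fun p t => α (x p) t 3, fun p t => α (x p) t 5, fun p hp => ?_,
    fun t ht => ⟨hcont t ht 0, hcont t ht 2, hcont t ht 3, hcont t ht 5⟩⟩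
  obtain ⟨h0, hd⟩ := hα (x p) (hxr hp)
  have hd' : ∀ i, ∀ t ∈ Icc (0 : ℝ) 1,
      HasDerivAt (fun t => α (x p) t i) (shotField (B (α (x p) t)) i) t :=
    fun i t ht => (hasDerivAt_pi.1 (hd t ht)) i
  have hl : ∀ t ∈ Icc (0 : ℝ) 1, trunc 4 (α (x p) t 4) = p.2 := by
    intro t ht
    have h1 := sub_le_sub_of_hasDerivAt_le (hd' 4) (fun t _ => hasDerivAt_const t (0 : ℝ))
      (fun t _ => le_of_eq (by simp [shotField])) (left_mem_Icc.2 zero_le_one) ht ht.1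
    have h2 := sub_le_sub_of_hasDerivAt_le (fun t _ => hasDerivAt_const t (0 : ℝ)) (hd' 4)
      (fun t _ => le_of_eq (by simp [shotField])) (left_mem_Icc.2 zero_le_one) ht ht.1
    have h3 : α (x p) 0 4 = p.2 := by rw [h0]; simp [hx]
    have h4 : α (x p) t 4 = p.2 := by simp only [h3] at h1 h2; linarith
    rw [h4, trunc_of_mem hp.2.1 hp.2.2]
  have ht' : ∀ t ∈ Icc (0 : ℝ) 1, trunc 1 (α (x p) t 6) = t := by
    intro t ht
    have h1 := sub_le_sub_of_hasDerivAt_le (hd' 6) (fun t _ => hasDerivAt_id t)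
      (fun t _ => le_of_eq (by simp [shotField])) (left_mem_Icc.2 zero_le_one) ht ht.1
    have h2 := sub_le_sub_of_hasDerivAt_le (fun t _ => hasDerivAt_id t) (hd' 6)
      (fun t _ => le_of_eq (by simp [shotField])) (left_mem_Icc.2 zero_le_one) ht ht.1
    have h3 : α (x p) 0 6 = 0 := by rw [h0]; simp [hx]
    have h4 : α (x p) t 6 = t := by simp only [h3, id] at h1 h2; linarith
    rw [h4, trunc_of_mem ht.1 ht.2]
  constructor
  · exact (congrFun h0 0).trans (by simp [hx])
  · exact (congrFun h0 1).trans (by simp [hx])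
  · exact (congrFun h0 2).trans (by simp [hx])
  · exact (congrFun h0 3).trans (by simp [hx])
  · exact (congrFun h0 5).trans (by simp [hx])
  · exact fun t ht => hd' 0 t ht
  · exact fun t ht => hd' 1 t ht
  · exact fun t ht => hd' 2 t ht
  · intro t ht
    convert hd' 3 t ht using 1
    simp [shotField, hB, shotCorner, hl t ht, ht' t ht]
  · intro t ht
    convert hd' 5 t ht using 1
    simp [shotField, hB, shotCorner, ht' t ht]

lemma tan_trunc_mono {ρ x y : ℝ} (hρ : 0 < ρ) (h : x ≤ y) :
    Real.tan (trunc (Real.arctan ρ) x) ≤ Real.tan (trunc (Real.arctan ρ) y) := by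
  have hA := Real.arctan_pos.2 hρ
  have hmem : ∀ x, trunc (Real.arctan ρ) x ∈ Ioo (-(Real.pi / 2)) (Real.pi / 2) := fun x =>
    ⟨by linarith [trunc_nonneg (Real.arctan ρ) x, Real.pi_pos],
      (trunc_le hA.le x).trans_lt (Real.arctan_lt_pi_div_two ρ)⟩
  exact Real.strictMonoOn_tan.monotoneOn (hmem x) (hmem y) (trunc_mono _ h)

lemma tan_trunc_nonneg {ρ : ℝ} (hρ : 0 < ρ) (x : ℝ) :
    0 ≤ Real.tan (trunc (Real.arctan ρ) x) :=
  Real.tan_nonneg_of_nonneg_of_le_pi_div_two (trunc_nonneg _ _)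
    ((trunc_le (Real.arctan_pos.2 hρ).le x).trans (Real.arctan_lt_pi_div_two ρ).le)

lemma tan_trunc_le {ρ : ℝ} (hρ : 0 < ρ) (x : ℝ) :
    Real.tan (trunc (Real.arctan ρ) x) ≤ ρ := by
  have hA := Real.arctan_pos.2 hρ
  have h := tan_trunc_mono hρ (le_max_left x (Real.arctan ρ))
  rwa [show trunc (Real.arctan ρ) (max x (Real.arctan ρ)) = Real.arctan ρ by
    simp [trunc, hA.le], Real.tan_arctan] at h

lemma continuous_tan_trunc {ρ : ℝ} (hρ : 0 < ρ) :
    Continuous fun x => Real.tan (trunc (Real.arctan ρ) x) := by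
  have hA := Real.arctan_pos.2 hρ
  refine Real.continuousOn_tan_Ioo.comp_continuous (continuous_trunc _) fun x =>
    ⟨by linarith [trunc_nonneg (Real.arctan ρ) x, Real.pi_pos],
      (trunc_le hA.le x).trans_lt (Real.arctan_lt_pi_div_two ρ)⟩

namespace IsShot

variable {ρ a a' l : ℝ} {u v z θ h u' v' z' θ' h' : ℝ → ℝ}

lemma h_one_nonneg (S : IsShot ρ a l u v z θ h) : 0 ≤ h 1 := by
  have := sub_le_sub_of_hasDerivAt_le (fun t _ => hasDerivAt_const t (0 : ℝ)) S.deriv_h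
    (fun t ht => mul_nonneg (pow_nonneg ht.1 3) (trunc_nonneg _ _))
    (left_mem_Icc.2 zero_le_one) (right_mem_Icc.2 zero_le_one) zero_le_one
  linarith [S.h_zero]

/-- The shooting problem is monotone in the initial value of `u″`. -/
lemma sub_le_sub (S : IsShot ρ a l u v z θ h) (S' : IsShot ρ a' l u' v' z' θ' h')
    (hρ : 0 < ρ) (hl : 0 ≤ l) (ha : a < a') : a' - a ≤ z' 1 - z 1 := by
  have key : ∀ b ∈ Icc (0 : ℝ) 1, (∀ t ∈ Ico 0 b, z t < z' t) → a' - a ≤ z' b - z b := by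
    intro b hb hz
    have hsub : ∀ t ∈ Icc 0 b, t ∈ Icc (0 : ℝ) 1 := fun t ht => ⟨ht.1, ht.2.trans hb.2⟩
    have hz' : ∀ t ∈ Icc 0 b, z t ≤ z' t := by
      intro t ht
      rcases ht.2.eq_or_lt with rfl | hlt
      · rcases ht.1.eq_or_lt with rfl | h0
        · rw [S.z_zero, S'.z_zero]; exact ha.le
        · have hcl : t ∈ closure (Ico 0 t) := by
            rw [closure_Ico h0.ne]; exact right_mem_Icc.2 h0.le
          refine ContinuousWithinAt.closure_le hcl
            (S.deriv_z t hb).continuousAt.continuousWithinAt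
            (S'.deriv_z t hb).continuousAt.continuousWithinAt fun s hs => (hz s hs).le
      · exact (hz t ⟨ht.1, hlt⟩).le
    have hv : ∀ t ∈ Icc 0 b, v t ≤ v' t := fun t ht => by
      have := sub_le_sub_of_hasDerivAt_le (fun s hs => S.deriv_v s (hsub s hs))
        (fun s hs => S'.deriv_v s (hsub s hs)) (fun s hs => trunc_mono ρ (hz' s hs))
        (left_mem_Icc.2 hb.1) ht ht.1
      linarith [S.v_zero, S'.v_zero]
    have hu : ∀ t ∈ Icc 0 b, u t ≤ u' t := fun t ht => by
      have := sub_le_sub_of_hasDerivAt_le (fun s hs => S.deriv_u s (hsub s hs))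
        (fun s hs => S'.deriv_u s (hsub s hs)) (fun s hs => trunc_mono ρ (hv s hs))
        (left_mem_Icc.2 hb.1) ht ht.1
      linarith [S.u_zero, S'.u_zero]
    have hθ : ∀ t ∈ Icc 0 b, θ' t ≤ θ t := fun t ht => by
      have := sub_le_sub_of_hasDerivAt_le (fun s hs => S'.deriv_θ s (hsub s hs))
        (fun s hs => S.deriv_θ s (hsub s hs))
        (fun s hs => neg_le_neg (mul_le_mul_of_nonneg_left
          (Real.exp_le_exp.2 (trunc_mono ρ (hu s hs))) (mul_nonneg hl hs.1)))
        (left_mem_Icc.2 hb.1) ht ht.1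
      linarith [S.θ_zero, S'.θ_zero]
    have := sub_le_sub_of_hasDerivAt_le (fun s hs => S.deriv_z s (hsub s hs))
      (fun s hs => S'.deriv_z s (hsub s hs))
      (fun s hs => neg_le_neg (tan_trunc_mono hρ (hθ s hs)))
      (left_mem_Icc.2 hb.1) (right_mem_Icc.2 hb.1) hb.1
    linarith [S.z_zero, S'.z_zero]
  refine key 1 (right_mem_Icc.2 zero_le_one) ?_
  by_contra! hne
  obtain ⟨t₀, ht₀, hlt₀⟩ := hne
  set s : Set ℝ := Icc 0 1 ∩ {t | z' t - z t ∈ Iic 0} with hs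
  have hcl : IsClosed s := ContinuousOn.preimage_isClosed_of_isClosed
    (fun t ht => ((S'.deriv_z t ht).sub (S.deriv_z t ht)).continuousAt.continuousWithinAt)
    isClosed_Icc isClosed_Iic
  have hbdd : BddBelow s := ⟨0, fun t ht => ht.1.1⟩
  have hmem := hcl.csInf_mem ⟨t₀, ⟨ht₀.1, ht₀.2.le⟩, by simpa using hlt₀⟩ hbdd
  have := key (sInf s) hmem.1 fun t ht => by
    by_contra! hle
    exact absurd (csInf_le hbdd
      (show t ∈ s from ⟨⟨ht.1, ht.2.le.trans hmem.1.2⟩, by simpa using hle⟩)) (not_le.2 ht.2)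
  have h0 : z' (sInf s) - z (sInf s) ≤ 0 := hmem.2
  linarith

lemma abs_sub_le (S : IsShot ρ a l u v z θ h) (S' : IsShot ρ a' l u' v' z' θ' h')
    (hρ : 0 < ρ) (hl : 0 ≤ l) : |a' - a| ≤ |z' 1 - z 1| := by
  rcases lt_trichotomy a a' with hlt | rfl | hlt
  · rw [abs_of_pos (sub_pos.2 hlt)]
    exact (S.sub_le_sub S' hρ hl hlt).trans (le_abs_self _)
  · simp
  · rw [abs_sub_comm, abs_sub_comm (z' 1), abs_of_pos (sub_pos.2 hlt)]
    exact (S'.sub_le_sub S hρ hl hlt).trans (le_abs_self _)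

end IsShot

/-- For some positive `l`, a solution of the shooting problem satisfies both boundary
conditions at `1`. -/
lemma exists_shot {ρ : ℝ} (hρ : 0 < ρ) :
    ∃ a l, 0 < l ∧ ∃ u v z θ h : ℝ → ℝ, IsShot ρ a l u v z θ h ∧ z 1 = 0 ∧
      Real.tan (trunc (Real.arctan ρ) (θ 1)) = l * (1 / (1 + u (1 / 2) ^ 2) + h 1) := by
  obtain ⟨u, v, z, θ, h, hS, hc⟩ := exists_shot_family hρ
  have m0 : (0 : ℝ) ∈ Icc (0 : ℝ) 1 := left_mem_Icc.2 zero_le_one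
  have m1 : (1 : ℝ) ∈ Icc (0 : ℝ) 1 := right_mem_Icc.2 zero_le_one
  have hex : ∀ l ∈ Icc (0 : ℝ) 4, ∃ a ∈ Icc (0 : ℝ) ρ, z (a, l) 1 = 0 := by
    intro l hl
    have hcont : ContinuousOn (fun a => z (a, l) 1) (Icc 0 ρ) :=
      (hc 1 m1).2.1.comp (by fun_prop) fun a ha => ⟨ha, hl⟩
    refine intermediate_value_Icc hρ.le hcont ⟨?_, ?_⟩
    · have S := hS (0, l) ⟨left_mem_Icc.2 hρ.le, hl⟩
      have := sub_le_sub_of_hasDerivAt_le S.deriv_z (fun t _ => hasDerivAt_const t (0 : ℝ))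
        (fun t _ => neg_nonpos.2 (tan_trunc_nonneg hρ _)) m0 m1 zero_le_one
      have h0 := S.z_zero
      simp only at h0 ⊢
      linarith
    · have S := hS (ρ, l) ⟨right_mem_Icc.2 hρ.le, hl⟩
      have := sub_le_sub_of_hasDerivAt_le (fun t _ => (hasDerivAt_id t).const_mul (-ρ)) S.deriv_z
        (fun t _ => by simpa using tan_trunc_le hρ _) m0 m1 zero_le_one
      have h0 := S.z_zero
      simp only [id] at h0 this ⊢
      linarith
  choose! a ha haz using hex
  have hp : ∀ l ∈ Icc (0 : ℝ) 4, (a l, l) ∈ Icc (0 : ℝ) ρ ×ˢ Icc (0 : ℝ) 4 :=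
    fun l hl => ⟨ha l hl, hl⟩
  have hac : ContinuousOn a (Icc 0 4) := by
    intro l hl
    have hz : ContinuousWithinAt (fun m => z (a l, m) 1) (Icc 0 4) l :=
      (((hc 1 m1).2.1.comp (f := fun m => (a l, m)) (by fun_prop)
        fun m hm => ⟨ha l hl, hm⟩) : ContinuousOn _ (Icc (0 : ℝ) 4)) l hl
    have hz0 : Tendsto (fun m => |z (a l, m) 1|) (𝓝[Icc 0 4] l) (𝓝 0) := by
      simpa [ContinuousWithinAt, haz l hl] using hz.abs
    rw [ContinuousWithinAt, tendsto_iff_dist_tendsto_zero]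
    refine squeeze_zero' (Eventually.of_forall fun _ => dist_nonneg) ?_ hz0
    filter_upwards [self_mem_nhdsWithin] with m hm
    have := (hS (a l, m) ⟨ha l hl, hm⟩).abs_sub_le (hS (a m, m) (hp m hm)) hρ hm.1
    rw [haz m hm, zero_sub, abs_neg] at this
    exact this
  have hpc : ContinuousOn (fun l => (a l, l)) (Icc 0 4) := hac.prodMk continuousOn_id
  have hcomp : ∀ f : ℝ × ℝ → ℝ, ContinuousOn f (Icc (0 : ℝ) ρ ×ˢ Icc (0 : ℝ) 4) →
      ContinuousOn (fun l => f (a l, l)) (Icc 0 4) := fun f hf => hf.comp hpc hp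
  have hHpos : ∀ l ∈ Icc (0 : ℝ) 4,
      0 < 1 / (1 + u (a l, l) (1 / 2) ^ 2) + h (a l, l) 1 := fun l hl =>
    add_pos_of_pos_of_nonneg (by positivity) (hS _ (hp l hl)).h_one_nonneg
  have hφ : ContinuousOn (fun l => Real.tan (trunc (Real.arctan ρ) (θ (a l, l) 1)) -
      l * (1 / (1 + u (a l, l) (1 / 2) ^ 2) + h (a l, l) 1)) (Icc 0 4) := by
    refine ((continuous_tan_trunc hρ).comp_continuousOn (hcomp _ (hc 1 m1).2.2.1)).sub
      (continuousOn_id.mul (ContinuousOn.add (ContinuousOn.div continuousOn_const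
        (continuousOn_const.add ((hcomp _ (hc (1 / 2) (by norm_num)).1).pow 2))
        fun l _ => by positivity) (hcomp _ (hc 1 m1).2.2.2)))
  have hφ0 : ∀ l ∈ Icc (0 : ℝ) 4, l = 0 → Real.tan (trunc (Real.arctan ρ) (θ (a l, l) 1)) = ρ := by
    rintro l hl rfl
    have S := hS _ (hp 0 hl)
    have := sub_le_sub_of_hasDerivAt_le (fun t _ => hasDerivAt_const t (0 : ℝ)) S.deriv_θ
      (fun t _ => by simp) m0 m1 zero_le_one
    have h0 := S.θ_zero
    refine le_antisymm (tan_trunc_le hρ _) ?_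
    have h1 := tan_trunc_mono hρ (show Real.arctan ρ ≤ θ (a 0, 0) 1 by linarith)
    rwa [trunc_of_mem (Real.arctan_pos.2 hρ).le le_rfl, Real.tan_arctan] at h1
  have h4 : Real.tan (trunc (Real.arctan ρ) (θ (a 4, 4) 1)) = 0 := by
    have S := hS _ (hp 4 (right_mem_Icc.2 (by norm_num)))
    have := sub_le_sub_of_hasDerivAt_le S.deriv_θ
      (fun t _ => ((hasDerivAt_pow 2 t).const_mul (-2)))
      (fun t ht => by
        have h1 := Real.one_le_exp (trunc_nonneg ρ (u (a 4, 4) t))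
        have h2 := mul_le_mul_of_nonneg_left h1 ht.1
        norm_num
        linarith) m0 m1 zero_le_one
    have h0 := S.θ_zero
    have h5 := Real.arctan_lt_pi_div_two ρ
    have h6 := Real.pi_lt_four
    rw [trunc_of_nonpos (Real.arctan_pos.2 hρ).le (by norm_num at this; linarith), Real.tan_zero]
  have i0 : (0 : ℝ) ∈ Icc (0 : ℝ) 4 := by norm_num
  have i4 : (4 : ℝ) ∈ Icc (0 : ℝ) 4 := by norm_num
  obtain ⟨l, hl, hl0⟩ := intermediate_value_Icc' (by norm_num) hφ
    (show (0 : ℝ) ∈ Icc _ _ from ⟨by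
      simp only [h4]
      linarith [hHpos 4 i4], by
      simp only [hφ0 0 i0 rfl]
      linarith⟩)
  have hlne : l ≠ 0 := by
    rintro rfl
    simp only [hφ0 0 i0 rfl] at hl0
    linarith
  exact ⟨a l, l, lt_of_le_of_ne hl.1 hlne.symm, u (a l, l), v (a l, l), z (a l, l), θ (a l, l),
    h (a l, l), hS _ (hp l hl), haz l hl, sub_eq_zero.1 hl0⟩

lemma continuous_kern (t : ℝ) : Continuous (kern t) := by
  unfold kern
  exact Continuous.if_le (by fun_prop) (by fun_prop) continuous_const continuous_id
    (by rintro s rfl; ring)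

/-- Green's representation of the solution of `u⁗ = g`, `u(0) = u′(0) = u″(1) = 0`, where
`w = -u‴`. -/
lemma eq_gam_mul_add_integral_kern {u v z w g : ℝ → ℝ} (hg : Continuous g)
    (hu0 : u 0 = 0) (hv0 : v 0 = 0) (hz1 : z 1 = 0)
    (hu : ∀ t ∈ Icc (0 : ℝ) 1, HasDerivAt u (v t) t)
    (hv : ∀ t ∈ Icc (0 : ℝ) 1, HasDerivAt v (z t) t)
    (hz : ∀ t ∈ Icc (0 : ℝ) 1, HasDerivAt z (-w t) t)
    (hw : ∀ t ∈ Icc (0 : ℝ) 1, HasDerivAt w (-g t) t) {t : ℝ} (ht : t ∈ Icc (0 : ℝ) 1) :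
    u t = gam t * w 1 + ∫ s in (0 : ℝ)..1, kern t s * g s := by
  have hint : ∀ a b, IntervalIntegrable (fun s => kern t s * g s) volume a b :=
    fun a b => ((continuous_kern t).mul hg).intervalIntegrable a b
  have h1 : ∫ s in (0 : ℝ)..t, kern t s * g s = u t - t ^ 3 / 3 * w t - t ^ 2 / 2 * z t := by
    have hd : ∀ s ∈ uIcc 0 t, HasDerivAt
        (fun s => u s - (3 * s ^ 2 * t - s ^ 3) / 6 * w s - (2 * s * t - s ^ 2) / 2 * z s +
          (t - s) * v s) (kern t s * g s) s := by
      rw [uIcc_of_le ht.1]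
      intro s hs
      have hs' : s ∈ Icc (0 : ℝ) 1 := ⟨hs.1, hs.2.trans ht.2⟩
      have hk : kern t s = (3 * s ^ 2 * t - s ^ 3) / 6 := by
        unfold kern
        split_ifs with h
        · rw [le_antisymm hs.2 h]
        · rfl
      have hA : HasDerivAt (fun s : ℝ => (3 * s ^ 2 * t - s ^ 3) / 6)
          ((2 * s * t - s ^ 2) / 2) s := by
        refine HasDerivAt.congr_deriv (((((hasDerivAt_pow 2 s).const_mul 3).mul_const t).sub
          (hasDerivAt_pow 3 s)).div_const 6) ?_
        push_cast; ring
      have hA' : HasDerivAt (fun s : ℝ => (2 * s * t - s ^ 2) / 2) (t - s) s := by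
        refine HasDerivAt.congr_deriv (((((hasDerivAt_id s).const_mul 2).mul_const t).sub
          (hasDerivAt_pow 2 s)).div_const 2) ?_
        push_cast; ring
      have hA'' : HasDerivAt (fun s : ℝ => t - s) (-1) s := (hasDerivAt_id s).const_sub t
      refine HasDerivAt.congr_deriv
        ((((hu s hs').sub (hA.mul (hw s hs'))).sub (hA'.mul (hz s hs'))).add
        (hA''.mul (hv s hs'))) ?_
      rw [hk]; ring
    rw [intervalIntegral.integral_eq_sub_of_hasDerivAt hd (hint 0 t), hu0, hv0]
    ring
  have h2 : ∫ s in t..1, kern t s * g s = -gam t * w 1 + t ^ 3 / 3 * w t + t ^ 2 / 2 * z t := by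
    have hd : ∀ s ∈ uIcc t 1, HasDerivAt
        (fun s => -((3 * t ^ 2 * s - t ^ 3) / 6 * w s) - t ^ 2 / 2 * z s) (kern t s * g s) s := by
      rw [uIcc_of_le ht.2]
      intro s hs
      have hs' : s ∈ Icc (0 : ℝ) 1 := ⟨ht.1.trans hs.1, hs.2⟩
      have hA : HasDerivAt (fun s : ℝ => (3 * t ^ 2 * s - t ^ 3) / 6) (t ^ 2 / 2) s := by
        refine HasDerivAt.congr_deriv
          ((((hasDerivAt_id s).const_mul (3 * t ^ 2)).sub_const (t ^ 3)).div_const 6) ?_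
        ring
      refine HasDerivAt.congr_deriv
        ((hA.mul (hw s hs')).neg.sub ((hz s hs').const_mul (t ^ 2 / 2))) ?_
      rw [kern, if_pos hs.1]; ring
    rw [intervalIntegral.integral_eq_sub_of_hasDerivAt hd (hint t 1), hz1, gam]
    ring
  rw [← intervalIntegral.integral_add_adjacent_intervals (hint 0 t) (hint t 1), h1, h2]
  ring

lemma eqOn_Icc_of_hasDerivAt {f g f' : ℝ → ℝ} {a b : ℝ}
    (hf : ∀ t ∈ Icc a b, HasDerivAt f (f' t) t)
    (hg : ∀ t ∈ Icc a b, HasDerivAt g (f' t) t) (h0 : f a = g a) : EqOn f g (Icc a b) := by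
  intro t ht
  have ha := left_mem_Icc.2 (ht.1.trans ht.2)
  have h1 := sub_le_sub_of_hasDerivAt_le hf hg (fun _ _ => le_rfl) ha ht ht.1
  have h2 := sub_le_sub_of_hasDerivAt_le hg hf (fun _ _ => le_rfl) ha ht ht.1
  linarith

/-- A solution of the third order initial value problem `u‴ = -w` on `[0, 1]` with continuous `w`
extends to a function of class `C³` on `ℝ`. -/
lemma exists_contDiff_three_extension {u v z w : ℝ → ℝ} (hw : ContinuousOn w (Icc 0 1))
    (hu : ∀ t ∈ Icc (0 : ℝ) 1, HasDerivAt u (v t) t)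
    (hv : ∀ t ∈ Icc (0 : ℝ) 1, HasDerivAt v (z t) t)
    (hz : ∀ t ∈ Icc (0 : ℝ) 1, HasDerivAt z (-w t) t) :
    ∃ U : ℝ → ℝ, ContDiff ℝ 3 U ∧ EqOn U u (Icc 0 1) ∧ EqOn (deriv U) v (Icc 0 1) ∧
      EqOn (deriv^[2] U) z (Icc 0 1) ∧ EqOn (deriv^[3] U) (fun t => -w t) (Icc 0 1) := by
  have hprim : ∀ {f : ℝ → ℝ} (_ : Continuous f) (c : ℝ), ∃ F : ℝ → ℝ, F 0 = c ∧
      ∀ t, HasDerivAt F (f t) t := fun {f} hf c =>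
    ⟨fun t => c + ∫ s in (0 : ℝ)..t, f s, by simp, fun t =>
      (intervalIntegral.integral_hasDerivAt_right (hf.intervalIntegrable _ _)
        hf.stronglyMeasurable.stronglyMeasurableAtFilter hf.continuousAt).const_add c⟩
  have hcont : ∀ {F f : ℝ → ℝ}, (∀ t, HasDerivAt F (f t) t) → Continuous F := fun hF =>
    continuous_iff_continuousAt.2 fun t => (hF t).continuousAt
  set W : ℝ → ℝ := IccExtend zero_le_one ((Icc (0 : ℝ) 1).domRestrict fun t => -w t) with hW
  have hWc : Continuous W := hw.neg.domRestrict.Icc_extend'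
  have hWw : ∀ t ∈ Icc (0 : ℝ) 1, W t = -w t := fun t ht => IccExtend_of_mem _ _ ht
  obtain ⟨Z, hZ0, hZ⟩ := hprim hWc (z 0)
  obtain ⟨V, hV0, hV⟩ := hprim (hcont hZ) (v 0)
  obtain ⟨U, hU0, hU⟩ := hprim (hcont hV) (u 0)
  have dU : deriv U = V := funext fun t => (hU t).deriv
  have dV : deriv V = Z := funext fun t => (hV t).deriv
  have dZ : deriv Z = W := funext fun t => (hZ t).deriv
  have eZ : EqOn Z z (Icc 0 1) := eqOn_Icc_of_hasDerivAt (fun t _ => hZ t)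
    (fun t ht => by rw [hWw t ht]; exact hz t ht) hZ0
  have eV : EqOn V v (Icc 0 1) := eqOn_Icc_of_hasDerivAt (fun t _ => hV t)
    (fun t ht => by rw [eZ ht]; exact hv t ht) hV0
  have eU : EqOn U u (Icc 0 1) := eqOn_Icc_of_hasDerivAt (fun t _ => hU t)
    (fun t ht => by rw [eV ht]; exact hu t ht) hU0
  have cZ : ContDiff ℝ 1 Z := contDiff_one_iff_deriv.2
    ⟨fun t => (hZ t).differentiableAt, dZ ▸ hWc⟩
  have cV : ContDiff ℝ (1 + 1) V := contDiff_succ_iff_deriv.2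
    ⟨fun t => (hV t).differentiableAt, by simp, dV ▸ cZ⟩
  have cU : ContDiff ℝ (1 + 1 + 1) U := contDiff_succ_iff_deriv.2
    ⟨fun t => (hU t).differentiableAt, by simp, dU ▸ cV⟩
  refine ⟨U, by norm_num at cU; exact cU, eU, dU ▸ eV, ?_, ?_⟩
  · simpa [dU, dV] using eZ
  · intro t ht
    simpa [dU, dV, dZ] using hWw t ht

lemma supN_le {w : ℝ → ℝ} {c : ℝ} (h : ∀ t ∈ Icc (0 : ℝ) 1, |w t| ≤ c) : supN w ≤ c :=
  ciSup_le fun t => h t t.2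

lemma le_supN {w : ℝ → ℝ} {c : ℝ} (h : ∀ t ∈ Icc (0 : ℝ) 1, |w t| ≤ c) {t : ℝ}
    (ht : t ∈ Icc (0 : ℝ) 1) : |w t| ≤ supN w :=
  le_ciSup (f := fun t : Icc (0 : ℝ) 1 => |w t|) ⟨c, by rintro _ ⟨t, rfl⟩; exact h t t.2⟩ ⟨t, ht⟩

/-- A solution of the shooting problem satisfying the boundary conditions at `1` does not feel the
truncations, and solves the original problem with `w = -u‴`. -/
lemma IsShot.exists_untruncated {ρ a l : ℝ} {u v z θ h : ℝ → ℝ} (S : IsShot ρ a l u v z θ h)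
    (hρ : 0 < ρ) (hl : 0 < l) (hz1 : z 1 = 0)
    (hθ1 : Real.tan (trunc (Real.arctan ρ) (θ 1)) = l * (1 / (1 + u (1 / 2) ^ 2) + h 1)) :
    ∃ w : ℝ → ℝ, w 0 = ρ ∧ w 1 = l * (1 / (1 + u (1 / 2) ^ 2) + h 1) ∧
      (∀ t ∈ Icc (0 : ℝ) 1, u t ∈ Icc 0 ρ ∧ v t ∈ Icc 0 ρ ∧ z t ∈ Icc 0 ρ ∧ w t ∈ Icc 0 ρ) ∧
      (∀ t ∈ Icc (0 : ℝ) 1, HasDerivAt u (v t) t ∧ HasDerivAt v (z t) t ∧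
        HasDerivAt z (-w t) t ∧ HasDerivAt w (-(l * (t * Real.exp (u t) * (1 + w t ^ 2)))) t ∧
        HasDerivAt h (t ^ 3 * z t) t) := by
  have hA := Real.arctan_pos.2 hρ
  have hA2 := Real.arctan_lt_pi_div_two ρ
  have m0 : (0 : ℝ) ∈ Icc (0 : ℝ) 1 := left_mem_Icc.2 zero_le_one
  have m1 : (1 : ℝ) ∈ Icc (0 : ℝ) 1 := right_mem_Icc.2 zero_le_one
  have dc : ∀ c : ℝ, ∀ t ∈ Icc (0 : ℝ) 1, HasDerivAt (fun t => c * t) (c * 1) t :=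
    fun c t _ => (hasDerivAt_id t).const_mul c
  have hθ1pos : 0 < θ 1 := by
    by_contra! hle
    rw [trunc_of_nonpos hA.le hle, Real.tan_zero] at hθ1
    have : 0 < l * (1 / (1 + u (1 / 2) ^ 2) + h 1) :=
      mul_pos hl (add_pos_of_pos_of_nonneg (by positivity) S.h_one_nonneg)
    linarith
  have hθ' : ∀ t ∈ Icc (0 : ℝ) 1, -(l * t * Real.exp (trunc ρ (u t))) ≤ 0 * 1 := fun t ht => by
    have := ht.1
    rw [zero_mul, neg_nonpos]
    positivity
  have hθ : ∀ t ∈ Icc (0 : ℝ) 1, θ t ∈ Icc 0 (Real.arctan ρ) := fun t ht => by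
    have h1 := sub_le_sub_of_hasDerivAt_le S.deriv_θ (dc 0) hθ' m0 ht ht.1
    have h2 := sub_le_sub_of_hasDerivAt_le S.deriv_θ (dc 0) hθ' ht m1 ht.2
    simp only [S.θ_zero] at h1 h2
    constructor <;> linarith
  have hθt : ∀ t ∈ Icc (0 : ℝ) 1, trunc (Real.arctan ρ) (θ t) = θ t := fun t ht =>
    trunc_of_mem (hθ t ht).1 (hθ t ht).2
  have hw : ∀ t ∈ Icc (0 : ℝ) 1, Real.tan (θ t) ∈ Icc 0 ρ := fun t ht => by
    rw [← hθt t ht]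
    exact ⟨tan_trunc_nonneg hρ _, tan_trunc_le hρ _⟩
  have dz : ∀ t ∈ Icc (0 : ℝ) 1, HasDerivAt z (-Real.tan (θ t)) t := fun t ht => by
    have := S.deriv_z t ht
    rwa [hθt t ht] at this
  have hz : ∀ t ∈ Icc (0 : ℝ) 1, z t ∈ Icc 0 ρ := fun t ht => by
    have h1 := sub_le_sub_of_hasDerivAt_le dz (dc 0)
      (fun t ht => by linarith [(hw t ht).1]) ht m1 ht.2
    have h2 := sub_le_sub_of_hasDerivAt_le (dc (-ρ)) dz
      (fun t ht => by linarith [(hw t ht).2]) ht m1 ht.2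
    have h3 := mul_nonneg hρ.le ht.1
    constructor <;> linarith
  have dv : ∀ t ∈ Icc (0 : ℝ) 1, HasDerivAt v (z t) t := fun t ht => by
    have := S.deriv_v t ht
    rwa [trunc_of_mem (hz t ht).1 (hz t ht).2] at this
  have hprim : ∀ f f' : ℝ → ℝ, f 0 = 0 → (∀ t ∈ Icc (0 : ℝ) 1, HasDerivAt f (f' t) t) →
      (∀ t ∈ Icc (0 : ℝ) 1, f' t ∈ Icc 0 ρ) → ∀ t ∈ Icc (0 : ℝ) 1, f t ∈ Icc 0 ρ := by
    intro f f' hf0 hf hf' t ht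
    have h1 := sub_le_sub_of_hasDerivAt_le (dc 0) hf
      (fun t ht => by linarith [(hf' t ht).1]) m0 ht ht.1
    have h2 := sub_le_sub_of_hasDerivAt_le hf (dc ρ)
      (fun t ht => by linarith [(hf' t ht).2]) m0 ht ht.1
    have h3 := mul_le_mul_of_nonneg_left ht.2 hρ.le
    constructor <;> linarith
  have hv := hprim v z S.v_zero dv hz
  have du : ∀ t ∈ Icc (0 : ℝ) 1, HasDerivAt u (v t) t := fun t ht => by
    have := S.deriv_u t ht
    rwa [trunc_of_mem (hv t ht).1 (hv t ht).2] at this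
  have hu := hprim u v S.u_zero du hv
  refine ⟨fun t => Real.tan (θ t), ?_, ?_, fun t ht => ⟨hu t ht, hv t ht, hz t ht, hw t ht⟩,
    fun t ht => ⟨du t ht, dv t ht, dz t ht, ?_, ?_⟩⟩
  · simp only [S.θ_zero, Real.tan_arctan]
  · rwa [hθt 1 m1] at hθ1
  · have hc : Real.cos (θ t) ≠ 0 := (Real.cos_pos_of_mem_Ioo
      ⟨by linarith [(hθ t ht).1, Real.pi_pos], (hθ t ht).2.trans_lt hA2⟩).ne'
    have := S.deriv_θ t ht
    rw [trunc_of_mem (hu t ht).1 (hu t ht).2] at this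
    refine HasDerivAt.congr_deriv ((Real.hasDerivAt_tan hc).comp t this) ?_
    rw [one_div, ← Real.inv_one_add_tan_sq hc, inv_inv]
    ring
  · have := S.deriv_h t ht
    rwa [trunc_of_mem (hz t ht).1 (hz t ht).2] at this

/-- For every `ρ > 0` there exist `λ_ρ ∈ (0,∞)` and `u_ρ ∈ ∂K_ρ` with
`‖u_ρ‖₃ = ‖u_ρ‴‖_∞ = ρ` satisfying
`u_ρ(t) = λ_ρ(γ(t)H[u_ρ] + ∫₀¹ k(t,s) s e^{u_ρ(s)}(1 + (u_ρ‴(s))²) ds)` on `[0,1]`,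
and `4ρ/(2e^ρρ² + 2e^ρ + ρ + 4) ≤ λ_ρ ≤ 2ρ(ρ²+1)/(ρ²+3)`. -/
theorem example_eigenpairs :
    ∀ ρ > (0:ℝ), ∃ lam : ℝ, 0 < lam ∧ ∃ u ∈ Kbdry ρ,
      norm3 u = ρ ∧ supN (deriv^[3] u) = ρ ∧
      (∀ t ∈ Icc (0:ℝ) 1, u t = lam * (gam t * HEx u +
        ∫ s in (0:ℝ)..1, kern t s *
          (s * Real.exp (u s) * (1 + (deriv^[3] u s) ^ 2)))) ∧
      4 * ρ / (2 * Real.exp ρ * ρ ^ 2 + 2 * Real.exp ρ + ρ + 4) ≤ lam ∧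
      lam ≤ 2 * ρ * (ρ ^ 2 + 1) / (ρ ^ 2 + 3) := by
  intro ρ hρ
  have m0 : (0 : ℝ) ∈ Icc (0 : ℝ) 1 := left_mem_Icc.2 zero_le_one
  have m1 : (1 : ℝ) ∈ Icc (0 : ℝ) 1 := right_mem_Icc.2 zero_le_one
  have mh : (1 / 2 : ℝ) ∈ Icc (0 : ℝ) 1 := by norm_num
  obtain ⟨a, l, hl, u, v, z, θ, h, S, hz1, hθ1⟩ := exists_shot hρ
  obtain ⟨w, hw0, hw1, hmem, hd⟩ := S.exists_untruncated hρ hl hz1 hθ1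
  have dw : ∀ t ∈ Icc (0 : ℝ) 1,
      HasDerivAt w (-(l * (t * Real.exp (u t) * (1 + w t ^ 2)))) t := fun t ht => (hd t ht).2.2.2.1
  have dh : ∀ t ∈ Icc (0 : ℝ) 1, HasDerivAt h (t ^ 3 * z t) t := fun t ht => (hd t ht).2.2.2.2
  obtain ⟨U, hU, eU, eV, eZ, eW⟩ := exists_contDiff_three_extension
    (fun t ht => (dw t ht).continuousAt.continuousWithinAt)
    (fun t ht => (hd t ht).1) (fun t ht => (hd t ht).2.1) (fun t ht => (hd t ht).2.2.1)
  have hcZ : Continuous (deriv^[2] U) := by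
    rw [← iteratedDeriv_eq_iterate]
    exact hU.continuous_iteratedDeriv 2 (by norm_num)
  have hcW : Continuous (deriv^[3] U) := by
    rw [← iteratedDeriv_eq_iterate]
    exact hU.continuous_iteratedDeriv 3 le_rfl
  have hH : HEx U = 1 / (1 + u (1 / 2) ^ 2) + h 1 := by
    rw [HEx, eU mh, intervalIntegral.integral_eq_sub_of_hasDerivAt (f := h), S.h_zero, sub_zero]
    · intro t ht
      rw [uIcc_of_le zero_le_one] at ht
      rw [eZ ht]
      exact dh t ht
    · exact Continuous.intervalIntegrable (by fun_prop) _ _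
  have abs_le : ∀ x ∈ Icc 0 ρ, |x| ≤ ρ := fun x hx => by rw [abs_of_nonneg hx.1]; exact hx.2
  have b0 : ∀ t ∈ Icc (0 : ℝ) 1, |U t| ≤ ρ := fun t ht => by
    rw [eU ht]; exact abs_le _ (hmem t ht).1
  have b1 : ∀ t ∈ Icc (0 : ℝ) 1, |deriv U t| ≤ ρ := fun t ht => by
    rw [eV ht]; exact abs_le _ (hmem t ht).2.1
  have b2 : ∀ t ∈ Icc (0 : ℝ) 1, |deriv^[2] U t| ≤ ρ := fun t ht => by
    rw [eZ ht]; exact abs_le _ (hmem t ht).2.2.1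
  have b3 : ∀ t ∈ Icc (0 : ℝ) 1, |deriv^[3] U t| ≤ ρ := fun t ht => by
    rw [eW ht, abs_neg]; exact abs_le _ (hmem t ht).2.2.2
  have hsup : supN (deriv^[3] U) = ρ := by
    refine le_antisymm (supN_le b3) (le_trans (le_of_eq ?_) (le_supN b3 m0))
    simp only [eW m0, hw0, abs_neg, abs_of_pos hρ]
  have hnorm : norm3 U = ρ := by
    rw [norm3, hsup, max_eq_right (supN_le b2)]
    exact max_eq_right (max_le (supN_le b0) (supN_le b1))
  refine ⟨l, hl, U, ⟨⟨hU, fun t ht => ?_⟩, hnorm⟩, hnorm, hsup, fun t ht => ?_, ?_, ?_⟩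
  · rw [eU ht, eV ht, eZ ht, eW ht, neg_neg]
    exact ⟨(hmem t ht).1.1, (hmem t ht).2.1.1, (hmem t ht).2.2.1.1, (hmem t ht).2.2.2.1⟩
  · have hUc := hU.continuous
    have := eq_gam_mul_add_integral_kern
      (g := fun s => l * (s * Real.exp (U s) * (1 + (deriv^[3] U s) ^ 2))) (by fun_prop)
      S.u_zero S.v_zero hz1 (fun t ht => (hd t ht).1) (fun t ht => (hd t ht).2.1)
      (fun t ht => (hd t ht).2.2.1)
      (fun t ht => by rw [eU ht, eW ht, neg_sq]; exact dw t ht) ht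
    rw [eU ht, this, hw1, ← hH, mul_add, ← intervalIntegral.integral_const_mul]
    congr 1
    · ring
    · exact intervalIntegral.integral_congr fun s _ => by ring
  · have h1 := sub_le_sub_of_hasDerivAt_le dh
      (fun t _ => (hasDerivAt_pow 4 t).const_mul (ρ / 4))
      (fun t ht => by
        have := mul_le_mul_of_nonneg_left (hmem t ht).2.2.1.2 (pow_nonneg ht.1 3)
        norm_num
        linarith) m0 m1 zero_le_one
    have h2 := sub_le_sub_of_hasDerivAt_le
      (fun t _ => (hasDerivAt_pow 2 t).const_mul (-(l * (Real.exp ρ * (1 + ρ ^ 2)) / 2))) dw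
      (fun t ht => by
        obtain ⟨⟨-, hu1⟩, -, -, hw2, hw3⟩ := hmem t ht
        have h3 : Real.exp (u t) * (1 + w t ^ 2) ≤ Real.exp ρ * (1 + ρ ^ 2) := by gcongr
        have h4 := mul_le_mul_of_nonneg_left h3 (mul_nonneg hl.le ht.1)
        norm_num
        linarith) m0 m1 zero_le_one
    have h5 : 1 / (1 + u (1 / 2) ^ 2) ≤ 1 := by
      rw [div_le_one (by positivity)]
      linarith [sq_nonneg (u (1 / 2))]
    simp only [S.h_zero, hw0, hw1] at h1 h2
    have h6 : l * (1 / (1 + u (1 / 2) ^ 2) + h 1) ≤ l * (1 + ρ / 4) :=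
      mul_le_mul_of_nonneg_left (by linarith) hl.le
    rw [div_le_iff₀ (by positivity)]
    linarith
  · have h1 := sub_le_sub_of_hasDerivAt_le (fun t _ => hasDerivAt_const t (0 : ℝ)) dh
      (fun t ht => mul_nonneg (pow_nonneg ht.1 3) (hmem t ht).2.2.1.1) m0 m1 zero_le_one
    have h2 := sub_le_sub_of_hasDerivAt_le dw
      (fun t _ => (hasDerivAt_pow 2 t).const_mul (-(l / 2)))
      (fun t ht => by
        have h3 : 1 * 1 ≤ Real.exp (u t) * (1 + w t ^ 2) :=
          mul_le_mul (Real.one_le_exp (hmem t ht).1.1) (by linarith [sq_nonneg (w t)])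
            zero_le_one (Real.exp_pos _).le
        have h4 := mul_le_mul_of_nonneg_left h3 (mul_nonneg hl.le ht.1)
        norm_num
        linarith) m0 m1 zero_le_one
    have h5 : 1 / (1 + ρ ^ 2) ≤ 1 / (1 + u (1 / 2) ^ 2) := by
      have := (hmem _ mh).1
      exact one_div_le_one_div_of_le (by positivity)
        (by linarith [pow_le_pow_left₀ this.1 this.2 2])
    simp only [S.h_zero, hw0, hw1] at h1 h2
    have h6 : l * (1 / (1 + ρ ^ 2)) ≤ l * (1 / (1 + u (1 / 2) ^ 2) + h 1) :=
      mul_le_mul_of_nonneg_left (by linarith) hl.le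
    have h7 : l * (1 / (1 + ρ ^ 2)) + l / 2 ≤ ρ := by linarith
    have h8 : l * (1 / (1 + ρ ^ 2)) + l / 2 = l * (ρ ^ 2 + 3) / (2 * (1 + ρ ^ 2)) := by
      field_simp
      ring
    rw [h8, div_le_iff₀ (by positivity)] at h7
    rw [le_div_iff₀ (by positivity)]
    linarith
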